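/- Let G = S₄ ≀ ℤ/3ℤ = (S₄)³ ⋊ ℤ/3ℤ, where ℤ/3ℤ acts by cyclically permuting the three factors. Then MaxDim(G) ≥ 6; that is, G has a family of 6 maximal subgroups in general position. -/

import Mathlib

/-- A sequence of group elements is irredundant if no element lies in the
subgroup generated by the others. -/
def Irredundant {G : Type*} [Group G] {n : ℕ} (g : Fin n → G) : Prop :=
  ∀ i, g i ∉ Subgroup.closure (g '' {j | j ≠ i})

/-- A sequence of group elements generates the group. -/
def Generates {G : Type*} [Group G] {n : ℕ} (g : Fin n → G) : Prop :=
  Subgroup.closure (Set.range g) = ⊤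

/-- A family of subgroups is in general position if removing any one member
strictly enlarges the intersection. -/
def InGeneralPosition {G : Type*} [Group G] {n : ℕ} (H : Fin n → Subgroup G) : Prop :=
  ∀ i, (⨅ j, H j) < ⨅ j ∈ {j | j ≠ i}, H j

/-- `mG G` is the maximum length of an irredundant generating sequence of `G`. -/
noncomputable def mG (G : Type*) [Group G] : ℕ :=
  sSup {n | ∃ g : Fin n → G, Irredundant g ∧ Generates g}

/-- `iG G` is the maximum length of an irredundant sequence in `G`. -/
noncomputable def iG (G : Type*) [Group G] : ℕ :=
  sSup {n | ∃ g : Fin n → G, Irredundant g}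

/-- `MaxDim G` is the maximum size of a family of maximal subgroups of `G`
in general position. -/
noncomputable def MaxDim (G : Type*) [Group G] : ℕ :=
  sSup {n | ∃ M : Fin n → Subgroup G, (∀ i, IsCoatom (M i)) ∧ InGeneralPosition M}

/-- The action of `ℤ/pℤ` on `(ZMod p → A)` by cyclically shifting coordinates. -/
def cycShift (p : ℕ) (A : Type*) [Group A] :
    Multiplicative (ZMod p) →* MulAut (ZMod p → A) where
  toFun k :=
    { toFun := fun f i => f (i + k.toAdd)
      invFun := fun f i => f (i - k.toAdd)
      left_inv := fun f => funext fun i => by simp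
      right_inv := fun f => funext fun i => by simp
      map_mul' := fun f g => rfl }
  map_one' := by
    ext f i
    simp
  map_mul' := fun a b => by
    ext f i
    simp [add_assoc]

/-- The wreath product `A ≀ ℤ/pℤ = (A)^p ⋊ ℤ/pℤ`, with `ℤ/pℤ` acting by cyclic
permutation of the coordinates. -/
abbrev Wreath (p : ℕ) (A : Type*) [Group A] :=
  SemidirectProduct (ZMod p → A) (Multiplicative (ZMod p)) (cycShift p A)

namespace Wreath

variable {n : ℕ} {α : Type*}

/-- The product action of `Perm α ≀ ℤ/nℤ` on `αⁿ`. -/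
instance productAction : MulAction (Wreath n (Equiv.Perm α)) (ZMod n → α) where
  smul g x := fun i => g.left i (x (i + g.right.toAdd))
  one_smul x := by
    funext i
    change x (i + 0) = x i
    rw [add_zero]
  mul_smul g h x := by
    funext i
    change g.left i (h.left (i + g.right.toAdd) (x (i + (g.right.toAdd + h.right.toAdd)))) =
      g.left i (h.left (i + g.right.toAdd) (x (i + g.right.toAdd + h.right.toAdd)))
    rw [add_assoc]

theorem smul_apply (g : Wreath n (Equiv.Perm α)) (x : ZMod n → α) (i : ZMod n) :
    (g • x) i = g.left i (x (i + g.right.toAdd)) := rfl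

theorem inl_smul_apply (f : ZMod n → Equiv.Perm α) (x : ZMod n → α) (i : ZMod n) :
    ((SemidirectProduct.inl f : Wreath n (Equiv.Perm α)) • x) i = f i (x i) := by
  simp [smul_apply]

/-- The element of the wreath product acting as `a` on coordinate `i` only. -/
def single {A : Type*} [Group A] (i : ZMod n) : A →* Wreath n A :=
  SemidirectProduct.inl.comp (MonoidHom.mulSingle (fun _ => A) i)

theorem single_smul (i : ZMod n) (a : Equiv.Perm α) (x : ZMod n → α) :
    single i a • x = Function.update x i (a (x i)) := by
  funext j
  change ((SemidirectProduct.inl (Pi.mulSingle i a) : Wreath n (Equiv.Perm α)) • x) j = _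
  rw [inl_smul_apply]
  by_cases h : j = i
  · subst h; simp
  · simp [h]

theorem single_mem_stabilizer {i : ZMod n} {a : Equiv.Perm α} {x : ZMod n → α}
    (h : a (x i) = x i) : single i a ∈ MulAction.stabilizer (Wreath n (Equiv.Perm α)) x := by
  rw [MulAction.mem_stabilizer_iff, single_smul, h, Function.update_eq_self]

theorem mul_single {A : Type*} [Group A] (g : Wreath n A) (i : ZMod n) (a : A) :
    g * single (i + g.right.toAdd) a = single i (g.left i * a * (g.left i)⁻¹) * g := by
  refine SemidirectProduct.ext ?_ ?_
  · funext j
    change g.left j * (Pi.mulSingle (i + g.right.toAdd) a : ZMod n → A) (j + g.right.toAdd) =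
      (Pi.mulSingle i (g.left i * a * (g.left i)⁻¹) : ZMod n → A) j * g.left (j + 0)
    rw [add_zero]
    by_cases h : j = i
    · subst h; simp
    · simp [h]
  · change g.right * 1 = 1 * g.right
    rw [mul_one, one_mul]

/-- A subgroup of `Perm α` containing the stabilizer of `a` and an element moving `a` is
everything. -/
theorem perm_mem_of_stabilizer_le {L : Subgroup (Equiv.Perm α)} {a : α}
    (hL : ∀ u : Equiv.Perm α, u a = a → u ∈ L) {b : Equiv.Perm α} (hb : b ∈ L) (hba : b a ≠ a)
    (x : Equiv.Perm α) : x ∈ L := by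
  classical
  by_cases hx : x a = a
  · exact hL x hx
  have hu : Equiv.swap (b a) (x a) ∈ L :=
    hL _ (Equiv.swap_apply_of_ne_of_ne (Ne.symm hba) (Ne.symm hx))
  have hw : (Equiv.swap (b a) (x a) * b)⁻¹ * x ∈ L := by
    apply hL
    rw [Equiv.Perm.mul_apply, Equiv.Perm.inv_eq_iff_eq]
    simp
  rw [← mul_inv_cancel_left (Equiv.swap (b a) (x a) * b) x]
  exact L.mul_mem (L.mul_mem hu hb) hw

/-- Point stabilizers of the product action are maximal as soon as `α` has three points. -/
theorem isCoatom_stabilizer [NeZero n] [Nontrivial α]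
    (hα : ∀ a b : α, ∃ c, c ≠ a ∧ c ≠ b) (x : ZMod n → α) :
    IsCoatom (MulAction.stabilizer (Wreath n (Equiv.Perm α)) x) := by
  classical
  have eq_top : ∀ K : Subgroup (Wreath n (Equiv.Perm α)),
      MulAction.stabilizer (Wreath n (Equiv.Perm α)) x ≤ K →
      ∀ k ∈ K, k • x ≠ x → K = ⊤ := by
    intro K hK k hk hkx
    obtain ⟨i, hi⟩ := Function.ne_iff.mp hkx
    obtain ⟨c, hc, hc'⟩ := hα (x i) ((k • x) i)
    have hjK : ∃ j, ∀ a, single j a ∈ K := by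
      refine ⟨i + k.right.toAdd, fun a => ?_⟩
      refine perm_mem_of_stabilizer_le
        (L := K.comap (single (i + k.right.toAdd))) (a := x (i + k.right.toAdd))
        (b := (k.left i)⁻¹ * Equiv.swap ((k • x) i) c * k.left i)
        (fun u hu => hK (single_mem_stabilizer hu)) ?_ ?_ a
      · have hswap : single i (Equiv.swap ((k • x) i) c) ∈ K :=
          hK (single_mem_stabilizer
            (Equiv.swap_apply_of_ne_of_ne (Ne.symm hi) (Ne.symm hc)))
        have hconj := mul_single k i ((k.left i)⁻¹ * Equiv.swap ((k • x) i) c * k.left i)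
        have hcancel : k.left i * ((k.left i)⁻¹ * Equiv.swap ((k • x) i) c * k.left i) *
            (k.left i)⁻¹ = Equiv.swap ((k • x) i) c := by group
        rw [hcancel] at hconj
        rw [Subgroup.mem_comap, ← K.mul_mem_cancel_left hk, hconj]
        exact K.mul_mem hswap hk
      · rw [Equiv.Perm.mul_apply, Equiv.Perm.mul_apply, ← smul_apply, Ne,
          Equiv.Perm.inv_eq_iff_eq, ← smul_apply, Equiv.swap_apply_left]
        exact hc'
    obtain ⟨j, hj⟩ := hjK
    have hsingle : ∀ l a, single l a ∈ K := by
      intro l a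
      let t : Wreath n (Equiv.Perm α) :=
        ⟨fun m => Equiv.swap (x (m + (j - l))) (x m), Multiplicative.ofAdd (j - l)⟩
      have ht : t ∈ K := by
        apply hK
        rw [MulAction.mem_stabilizer_iff]
        funext m
        exact Equiv.swap_apply_left _ _
      have hconj := mul_single t l ((t.left l)⁻¹ * a * t.left l)
      have hcancel : t.left l * ((t.left l)⁻¹ * a * t.left l) * (t.left l)⁻¹ = a := by group
      have hlj : l + t.right.toAdd = j := add_sub_cancel l j
      rw [hcancel, hlj] at hconj
      rw [← K.mul_mem_cancel_right ht, ← hconj]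
      exact K.mul_mem ht (hj _)
    have hbase : ∀ f : ZMod n → Equiv.Perm α, SemidirectProduct.inl f ∈ K := fun f =>
      Subgroup.pi_mem_of_mulSingle_mem (H := K.comap SemidirectProduct.inl) f
        (fun l => hsingle l (f l))
    refine (Subgroup.eq_top_iff' K).mpr fun g => ?_
    have hf := hbase fun l => Equiv.swap (x l) ((g • x) l)
    rw [← K.mul_mem_cancel_left (K.inv_mem hf)]
    apply hK
    rw [MulAction.mem_stabilizer_iff, mul_smul, inv_smul_eq_iff]
    funext l
    rw [inl_smul_apply, Equiv.swap_apply_left]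
  refine ⟨fun htop => ?_, fun K hlt => ?_⟩
  · obtain ⟨b, hb⟩ := exists_ne (x 0)
    have hmem : single 0 (Equiv.swap (x 0) b) ∈
        MulAction.stabilizer (Wreath n (Equiv.Perm α)) x := htop ▸ Subgroup.mem_top _
    rw [MulAction.mem_stabilizer_iff, single_smul] at hmem
    have h0 := congrFun hmem 0
    rw [Function.update_self, Equiv.swap_apply_left] at h0
    exact hb h0
  · obtain ⟨hle, k, hk, hkx⟩ := SetLike.lt_iff_le_and_exists.mp hlt
    exact eq_top K hle k hk hkx

end Wreath

theorem inGeneralPosition_of_exists {G : Type*} [Group G] {n : ℕ} {H : Fin n → Subgroup G}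
    (h : ∀ i, ∃ g, g ∉ H i ∧ ∀ j, j ≠ i → g ∈ H j) : InGeneralPosition H := by
  intro i
  obtain ⟨g, hgi, hg⟩ := h i
  refine SetLike.lt_iff_le_and_exists.mpr
    ⟨le_iInf₂ fun j _ => iInf_le H j, g, ?_, fun hmem => hgi (Subgroup.mem_iInf.mp hmem i)⟩
  simpa [Subgroup.mem_iInf] using hg

theorem InGeneralPosition.injective {G : Type*} [Group G] {n : ℕ} {H : Fin n → Subgroup G}
    (h : InGeneralPosition H) : Function.Injective H := by
  intro i j hij
  by_contra hne
  refine (h i).not_ge (le_iInf fun l g hg => ?_)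
  simp only [Subgroup.mem_iInf] at hg
  by_cases hl : l = i
  · rw [hl, hij]
    exact hg j (Ne.symm hne)
  · exact hg l hl

theorem le_MaxDim {G : Type*} [Group G] [Finite G] {n : ℕ} {M : Fin n → Subgroup G}
    (hM : ∀ i, IsCoatom (M i)) (h : InGeneralPosition M) : n ≤ MaxDim G := by
  refine le_csSup ⟨Nat.card (Subgroup G), ?_⟩ ⟨M, hM, h⟩
  rintro m ⟨M', -, h'⟩
  simpa using Nat.card_le_card_of_injective M' h'.injective

/-- Six points of `{0, 1, 2, 3}³`, each having a single nonzero coordinate, equal to `1` or `2`. -/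
def axisPoint (m : Fin 2 × ZMod 3) : ZMod 3 → Fin 4 :=
  Pi.single m.2 (m.1.castSucc.castSucc + 1)

theorem update_swap_axisPoint (m l : Fin 2 × ZMod 3) :
    Function.update (axisPoint l) m.2
      (Equiv.swap (m.1.castSucc.castSucc + 1) 3 (axisPoint l m.2)) = axisPoint l ↔ l ≠ m := by
  revert m l
  decide

/-- For `G = S₄ ≀ ℤ/3ℤ`, we have `MaxDim G ≥ 6`: `G` has a family of 6 maximal
subgroups in general position. -/
theorem MaxDim_S4_wreath_Z3_ge :
    6 ≤ MaxDim (Wreath 3 (Equiv.Perm (Fin 4))) ∧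
      ∃ M : Fin 6 → Subgroup (Wreath 3 (Equiv.Perm (Fin 4))),
        (∀ i, IsCoatom (M i)) ∧ InGeneralPosition M := by
  have : Finite (Wreath 3 (Equiv.Perm (Fin 4))) :=
    Finite.of_equiv _ SemidirectProduct.equivProd.symm
  let e : Fin 6 ≃ Fin 2 × ZMod 3 := (finProdFinEquiv (m := 2) (n := 3)).symm
  let M : Fin 6 → Subgroup (Wreath 3 (Equiv.Perm (Fin 4))) := fun i =>
    MulAction.stabilizer _ (axisPoint (e i))
  have hmax : ∀ i, IsCoatom (M i) := fun i => Wreath.isCoatom_stabilizer (by decide) _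
  have hpos : InGeneralPosition M := by
    refine inGeneralPosition_of_exists fun i =>
      ⟨Wreath.single (e i).2 (Equiv.swap ((e i).1.castSucc.castSucc + 1) 3), ?_, ?_⟩
    · rw [MulAction.mem_stabilizer_iff, Wreath.single_smul, update_swap_axisPoint]
      exact fun h => h rfl
    · intro j hji
      rw [MulAction.mem_stabilizer_iff, Wreath.single_smul, update_swap_axisPoint]
      exact e.injective.ne hji
  exact ⟨le_MaxDim hmax hpos, M, hmax, hpos⟩
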